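/- Every nondegenerate critical point of the electric potential has index 1 or 2: if x ∉ K is a critical point of Φ (i.e. fderiv ℝ Φ x = 0) and the Hessian bilinear form B(v, w) = (iteratedFDeriv ℝ 2 Φ x) v w is nondegenerate (for every v ≠ 0 there is w with B(v, w) ≠ 0), then there exist vectors v and w with B(v, v) > 0 and B(w, w) < 0; in particular the Hessian is neither positive definite nor negative definite, so the index of the critical point is 1 or 2. -/

import Mathlib

set_option maxSynthPendingDepth 3

open Set Filter Topology MeasureTheory

/-- Differentiation under the integral sign over a compact interval, for an integrand with jointly
continuous derivative. -/
lemma hasFDerivAt_intervalIntegral_of_continuousOn {E F : Type*}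
    [NormedAddCommGroup E] [NormedSpace ℝ E] [ProperSpace E]
    [NormedAddCommGroup F] [NormedSpace ℝ F] [CompleteSpace F]
    {U : Set E} (hU : IsOpen U) {f : E → ℝ → F} {f' : E → ℝ → E →L[ℝ] F}
    (hf : ∀ x ∈ U, Continuous (f x))
    (hf' : ContinuousOn (fun p : E × ℝ => f' p.1 p.2) (U ×ˢ univ))
    (hd : ∀ x ∈ U, ∀ t, HasFDerivAt (fun y => f y t) (f' x t) x)
    (a b : ℝ) {x : E} (hx : x ∈ U) :
    HasFDerivAt (fun y => ∫ t in a..b, f y t) (∫ t in a..b, f' x t) x := by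
  obtain ⟨ε, hε, hεU⟩ := Metric.nhds_basis_closedBall.mem_iff.1 (hU.mem_nhds hx)
  obtain ⟨C, hC⟩ := ((isCompact_closedBall x ε).prod
    (isCompact_uIcc (a := a) (b := b))).exists_bound_of_continuousOn
      (hf'.mono (prod_mono hεU (subset_univ _)))
  have hcont : Continuous (f' x) := by
    have : ContinuousOn (fun t : ℝ => f' x t) univ :=
      hf'.comp (f := fun t : ℝ => (x, t)) (by fun_prop) (fun t _ => ⟨hx, mem_univ t⟩)
    exact continuousOn_univ.1 this
  refine intervalIntegral.hasFDerivAt_integral_of_dominated_of_fderiv_le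
    (F' := f') (bound := fun _ => C) (Metric.closedBall_mem_nhds x hε) ?_
    ((hf x hx).intervalIntegrable _ _) hcont.aestronglyMeasurable ?_
    intervalIntegrable_const ?_
  · filter_upwards [hU.mem_nhds hx] with y hy using (hf y hy).aestronglyMeasurable
  · exact Eventually.of_forall fun t ht y hy => hC (y, t) ⟨hy, uIoc_subset_uIcc ht⟩
  · exact Eventually.of_forall fun t _ y hy => hd y (hεU hy) t

section NewtonKernel

variable {E : Type*} [NormedAddCommGroup E] [InnerProductSpace ℝ E]

/-- The real inner product as a continuous bilinear map. -/
noncomputable def realInnerCLM : E →L[ℝ] E →L[ℝ] ℝ := innerSL ℝ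

@[simp]
lemma realInnerCLM_apply (v w : E) : realInnerCLM v w = inner ℝ v w := rfl

/-- The derivative of `y ↦ ‖y‖⁻¹` away from the origin. -/
noncomputable def fderivInvNorm (y : E) : E →L[ℝ] ℝ :=
  -((‖y‖ ^ 3)⁻¹ • realInnerCLM y)

/-- The second derivative of `y ↦ ‖y‖⁻¹` away from the origin. -/
noncomputable def fderivTwoInvNorm (y : E) : E →L[ℝ] E →L[ℝ] ℝ :=
  (3 * (‖y‖ ^ 5)⁻¹) • (realInnerCLM y).smulRight (realInnerCLM y) - (‖y‖ ^ 3)⁻¹ • realInnerCLM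

lemma fderivTwoInvNorm_apply (y v w : E) :
    fderivTwoInvNorm y v w =
      3 * (‖y‖ ^ 5)⁻¹ * (inner ℝ y v * inner ℝ y w) - (‖y‖ ^ 3)⁻¹ * inner ℝ v w := by
  simp [fderivTwoInvNorm]

lemma hasFDerivAt_norm_of_ne_zero {y : E} (hy : y ≠ 0) :
    HasFDerivAt (fun y : E => ‖y‖) (‖y‖⁻¹ • realInnerCLM y) y := by
  have h := ((hasStrictFDerivAt_norm_sq y).hasFDerivAt.sqrt
    (pow_ne_zero 2 (norm_ne_zero_iff.2 hy)))
  simp only [Real.sqrt_sq (norm_nonneg _)] at h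
  convert h using 1
  ext v
  simp
  field_simp

lemma hasFDerivAt_inv_norm {y : E} (hy : y ≠ 0) :
    HasFDerivAt (fun y : E => ‖y‖⁻¹) (fderivInvNorm y) y := by
  have hn : ‖y‖ ≠ 0 := norm_ne_zero_iff.2 hy
  refine ((hasDerivAt_inv hn).comp_hasFDerivAt y (hasFDerivAt_norm_of_ne_zero hy)).congr_fderiv ?_
  ext v
  simp [fderivInvNorm]
  field_simp

lemma hasFDerivAt_fderivInvNorm {y : E} (hy : y ≠ 0) :
    HasFDerivAt (fderivInvNorm : E → E →L[ℝ] ℝ) (fderivTwoInvNorm y) y := by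
  have hn : ‖y‖ ≠ 0 := norm_ne_zero_iff.2 hy
  have h := (((hasDerivAt_pow 3 ‖y‖).inv (pow_ne_zero 3 hn)).comp_hasFDerivAt y
    (hasFDerivAt_norm_of_ne_zero hy)).smul realInnerCLM.hasFDerivAt
  refine h.neg.congr_fderiv ?_
  ext v w
  rw [fderivTwoInvNorm_apply]
  have happ : ∀ u v : E, (innerSL ℝ : E →L[ℝ] E →L[ℝ] ℝ) u v = inner ℝ u v := fun _ _ => rfl
  simp
  field_simp
  ring

lemma continuousOn_fderivInvNorm : ContinuousOn (fderivInvNorm : E → E →L[ℝ] ℝ) {0}ᶜ :=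
  fun _ hy => (hasFDerivAt_fderivInvNorm hy).continuousAt.continuousWithinAt

lemma continuousOn_fderivTwoInvNorm :
    ContinuousOn (fderivTwoInvNorm : E → E →L[ℝ] E →L[ℝ] ℝ) {0}ᶜ := by
  have hn : ∀ n : ℕ, ContinuousOn (fun y : E => (‖y‖ ^ n)⁻¹) {0}ᶜ := fun n =>
    ContinuousOn.inv₀ (by fun_prop) fun y hy => pow_ne_zero n (norm_ne_zero_iff.2 hy)
  have hs : Continuous fun y : E => (realInnerCLM y).smulRight (realInnerCLM y) := by
    change Continuous fun y : E =>
      ContinuousLinearMap.smulRightL ℝ E (E →L[ℝ] ℝ) (realInnerCLM y) (realInnerCLM y)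
    fun_prop
  exact ((continuousOn_const.mul (hn 5)).smul hs.continuousOn).sub
    ((hn 3).smul continuousOn_const)

/-- The Newton kernel is harmonic in dimension three. -/
lemma sum_fderivTwoInvNorm_eq_zero (b : OrthonormalBasis (Fin 3) ℝ E) {y : E} (hy : y ≠ 0) :
    ∑ i, fderivTwoInvNorm y (b i) (b i) = 0 := by
  have hn : ‖y‖ ≠ 0 := norm_ne_zero_iff.2 hy
  have hP : ∑ i, inner ℝ y (b i) * inner ℝ y (b i) = ‖y‖ ^ 2 := by
    rw [← real_inner_self_eq_norm_sq, ← b.sum_inner_mul_inner y y]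
    exact Finset.sum_congr rfl fun i _ => by rw [real_inner_comm y (b i)]
  simp only [fderivTwoInvNorm_apply, Finset.sum_sub_distrib, ← Finset.mul_sum, hP,
    real_inner_self_eq_norm_sq, b.norm_eq_one]
  simp
  field_simp
  ring

end NewtonKernel

/-- A symmetric bilinear form whose trace along a family `e` vanishes takes a positive value on
the diagonal, provided some `e i` is not in its kernel. -/
lemma exists_pos_of_sum_eq_zero {E ι : Type*} [AddCommGroup E] [Module ℝ E] [Fintype ι]
    (B : E →ₗ[ℝ] E →ₗ[ℝ] ℝ) (hsymm : ∀ v w, B v w = B w v) (e : ι → E)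
    (htr : ∑ i, B (e i) (e i) = 0) (i : ι) (hnd : ∃ w, B (e i) w ≠ 0) :
    ∃ v, 0 < B v v := by
  by_contra! h
  have h0 : B (e i) (e i) = 0 :=
    (Finset.sum_eq_zero_iff_of_nonpos fun j _ => h (e j)).1 htr i (Finset.mem_univ i)
  obtain ⟨w, hw⟩ := hnd
  have key : ∀ s : ℝ, 2 * s * B (e i) w + s ^ 2 * B w w ≤ 0 := fun s => by
    have := h (e i + s • w)
    simp [h0, hsymm w (e i)] at this
    linarith
  have hD : B w w ≤ 0 := h w
  have hpos : 0 < B (e i) w ^ 2 := by positivity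
  have h1 := key (B (e i) w / (1 - B w w))
  have hd : 0 < 1 - B w w := by linarith
  have : 2 * (B (e i) w / (1 - B w w)) * B (e i) w + (B (e i) w / (1 - B w w)) ^ 2 * B w w
      = B (e i) w ^ 2 * (2 - B w w) / (1 - B w w) ^ 2 := by
    field_simp
    ring
  rw [this] at h1
  have : 0 < B (e i) w ^ 2 * (2 - B w w) / (1 - B w w) ^ 2 := by
    have : 0 < 2 - B w w := by linarith
    positivity
  linarith

/-- Every nondegenerate critical point of the electric potential is a saddle:
the Hessian takes both positive and negative values on the diagonal, so the
index is 1 or 2. -/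
theorem critical_point_index_one_or_two
    (r : ℝ → EuclideanSpace ℝ (Fin 3))
    (hr : ContDiff ℝ (⊤ : ℕ∞) r)
    (hper : Function.Periodic r (2 * Real.pi))
    (hinj : Set.InjOn r (Set.Ico 0 (2 * Real.pi)))
    (hr' : ∀ t, deriv r t ≠ 0)
    (K : Set (EuclideanSpace ℝ (Fin 3))) (hK : K = Set.range r)
    (Φ : EuclideanSpace ℝ (Fin 3) → ℝ)
    (hΦ : ∀ x, Φ x = ∫ t in (0:ℝ)..(2 * Real.pi), ‖deriv r t‖ / ‖x - r t‖)
    (x : EuclideanSpace ℝ (Fin 3)) (hx : x ∉ K)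
    (hcrit : fderiv ℝ Φ x = 0)
    (hnondeg : ∀ v : EuclideanSpace ℝ (Fin 3), v ≠ 0 →
      ∃ w, (iteratedFDeriv ℝ 2 Φ x) ![v, w] ≠ 0) :
    (∃ v, (iteratedFDeriv ℝ 2 Φ x) ![v, v] > 0) ∧
    (∃ w, (iteratedFDeriv ℝ 2 Φ x) ![w, w] < 0) := by
  have hrc : Continuous r := hr.continuous
  have hcc : Continuous fun t => ‖deriv r t‖ := (hr.continuous_deriv (by simp)).norm
  have hKc : IsClosed K := by
    have : IsCompact K := by
      rw [hK, ← hper.image_uIcc (by positivity) 0]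
      exact isCompact_uIcc.image hrc
    exact this.isClosed
  have hU : IsOpen Kᶜ := hKc.isOpen_compl
  have hne : ∀ y ∈ Kᶜ, ∀ t, y - r t ≠ 0 := fun y hy t h =>
    hy (by rw [hK, sub_eq_zero.1 h]; exact mem_range_self t)
  have hmaps : MapsTo (fun p : EuclideanSpace ℝ (Fin 3) × ℝ => p.1 - r p.2)
      (Kᶜ ×ˢ univ) {0}ᶜ := fun p hp => hne p.1 hp.1 p.2
  have hsub : ContinuousOn (fun p : EuclideanSpace ℝ (Fin 3) × ℝ => p.1 - r p.2)
      (Kᶜ ×ˢ univ) := by fun_prop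
  have hc2 : ContinuousOn (fun p : EuclideanSpace ℝ (Fin 3) × ℝ => ‖deriv r p.2‖)
      (Kᶜ ×ˢ univ) := (hcc.comp continuous_snd).continuousOn
  have hf' := hc2.smul (continuousOn_fderivInvNorm.comp hsub hmaps)
  have hf'' := hc2.smul (continuousOn_fderivTwoInvNorm.comp hsub hmaps)
  have hslice : ∀ y ∈ Kᶜ, Continuous fun t => ‖deriv r t‖ • fderivInvNorm (y - r t) :=
    fun y hy => continuousOn_univ.1 (hf'.comp (f := fun t : ℝ => (y, t)) (by fun_prop)
      (fun t _ => ⟨hy, mem_univ t⟩))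
  have hslice2 : Continuous fun t => ‖deriv r t‖ • fderivTwoInvNorm (x - r t) :=
    continuousOn_univ.1 (hf''.comp (f := fun t : ℝ => (x, t)) (by fun_prop)
      (fun t _ => ⟨hx, mem_univ t⟩))
  have hD1 : ∀ y ∈ Kᶜ, HasFDerivAt Φ
      (∫ t in (0:ℝ)..(2 * Real.pi), ‖deriv r t‖ • fderivInvNorm (y - r t)) y := by
    intro y hy
    have hΦ' : Φ = fun y => ∫ t in (0:ℝ)..(2 * Real.pi), ‖deriv r t‖ • ‖y - r t‖⁻¹ := by
      funext y
      simp only [hΦ, div_eq_mul_inv, smul_eq_mul]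
    rw [hΦ']
    refine hasFDerivAt_intervalIntegral_of_continuousOn hU
      (f' := fun y t => ‖deriv r t‖ • fderivInvNorm (y - r t)) ?_ hf' ?_ _ _ hy
    · intro z hz
      exact hcc.smul ((by fun_prop : Continuous fun t => ‖z - r t‖).inv₀
        fun t => norm_ne_zero_iff.2 (hne z hz t))
    · intro z hz t
      exact ((hasFDerivAt_comp_sub (r t)).2 (hasFDerivAt_inv_norm (hne z hz t))).const_smul ‖deriv r t‖
  have hD2 : HasFDerivAt (fderiv ℝ Φ)
      (∫ t in (0:ℝ)..(2 * Real.pi), ‖deriv r t‖ • fderivTwoInvNorm (x - r t)) x := by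
    refine HasFDerivAt.congr_of_eventuallyEq
      (hasFDerivAt_intervalIntegral_of_continuousOn hU
        (f' := fun y t => ‖deriv r t‖ • fderivTwoInvNorm (y - r t)) hslice hf'' ?_ _ _ hx) ?_
    · intro z hz t
      exact ((hasFDerivAt_comp_sub (r t)).2 (hasFDerivAt_fderivInvNorm (hne z hz t))).const_smul ‖deriv r t‖
    · filter_upwards [hU.mem_nhds hx] with y hy using (hD1 y hy).fderiv
  have happ : ∀ v w, bilinearIteratedFDerivTwo ℝ Φ x v w =
      ∫ t in (0:ℝ)..(2 * Real.pi), ‖deriv r t‖ * fderivTwoInvNorm (x - r t) v w := by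
    intro v w
    have hi : IntervalIntegrable (fun t => ‖deriv r t‖ • fderivTwoInvNorm (x - r t))
        volume 0 (2 * Real.pi) := hslice2.intervalIntegrable _ _
    have hiv : IntervalIntegrable (fun t => (‖deriv r t‖ • fderivTwoInvNorm (x - r t)) v)
        volume 0 (2 * Real.pi) :=
      (hslice2.clm_apply continuous_const).intervalIntegrable _ _
    change fderiv ℝ (fderiv ℝ Φ) x v w = _
    rw [hD2.fderiv, ContinuousLinearMap.intervalIntegral_apply hi,
      ContinuousLinearMap.intervalIntegral_apply hiv]
    rfl
  have hsymm : ∀ v w, bilinearIteratedFDerivTwo ℝ Φ x v w =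
      bilinearIteratedFDerivTwo ℝ Φ x w v := by
    intro v w
    simp only [happ, fderivTwoInvNorm_apply, real_inner_comm v w,
      mul_comm (inner ℝ _ v) (inner ℝ _ w)]
  let b := EuclideanSpace.basisFun (Fin 3) ℝ
  have htr : ∑ i, bilinearIteratedFDerivTwo ℝ Φ x (b i) (b i) = 0 := by
    simp only [happ]
    rw [← intervalIntegral.integral_finsetSum]
    · simp only [← Finset.mul_sum, sum_fderivTwoInvNorm_eq_zero b (hne x hx _), mul_zero,
        intervalIntegral.integral_zero]
    · intro i _
      exact ((hslice2.clm_apply continuous_const).clm_apply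
        continuous_const).intervalIntegrable _ _
  have hb : b 0 ≠ 0 := b.orthonormal.ne_zero 0
  simp only [← bilinearIteratedFDerivTwo_eq_iteratedFDeriv] at hnondeg ⊢
  obtain ⟨w, hw⟩ := hnondeg _ hb
  refine ⟨exists_pos_of_sum_eq_zero _ hsymm b htr 0 ⟨w, hw⟩, ?_⟩
  obtain ⟨v, hv⟩ := exists_pos_of_sum_eq_zero (-bilinearIteratedFDerivTwo ℝ Φ x)
    (fun v w => by simp [hsymm v w]) b (by simp [htr]) 0 ⟨w, by simpa using hw⟩
  exact ⟨v, by simpa using hv⟩
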